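/- Let a_n denote the number of isomorphism classes of word-representable simple graphs with n vertices. Then a_n = 2^{n²/3 + o(n²)}; that is, (log₂ a_n − n²/3)/n² tends to 0 as n tends to infinity. -/

import Mathlib

def Alternates {V : Type*} [DecidableEq V] (w : List V) (x y : V) : Prop :=
  (w.filter (fun z => z = x ∨ z = y)).Chain' (· ≠ ·)

def Represents {V : Type*} [DecidableEq V] (w : List V) (G : SimpleGraph V) : Prop :=
  (∀ v : V, v ∈ w) ∧ ∀ x y : V, x ≠ y → (Alternates w x y ↔ G.Adj x y)

def WordRepresentable {V : Type*} [DecidableEq V] (G : SimpleGraph V) : Prop :=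
  ∃ w : List V, Represents w G

/-- The number of word-representable graphs on `n` vertices, counted up to isomorphism. -/
noncomputable def numUnlabelled (n : ℕ) : ℕ :=
  Nat.card
    (Quot (fun G H : {G : SimpleGraph (Fin n) // WordRepresentable G} => Nonempty (G.1 ≃g H.1)))


/-! ### Alternation through prefix counts -/

/-- Starting from the offset `d`, in every prefix the surplus of `x` over `y` stays in `{0, 1}`. -/
def Tracks {V : Type*} [DecidableEq V] (x y : V) (d : ℤ) (w : List V) : Prop :=
  ∀ p, p <+: w → 0 ≤ d + p.count x - p.count y ∧ d + p.count x - p.count y ≤ 1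

section words
variable {V : Type*} [DecidableEq V]

lemma tracks_nil (x y : V) (d : ℤ) : Tracks x y d [] ↔ 0 ≤ d ∧ d ≤ 1 := by
  simp [Tracks]

lemma tracks_append (x y : V) (d : ℤ) (u v : List V) :
    Tracks x y d (u ++ v) ↔ Tracks x y d u ∧ Tracks x y (d + u.count x - u.count y) v := by
  constructor
  · intro h
    refine ⟨fun p hp => h p (hp.trans (List.prefix_append u v)), fun p hp => ?_⟩
    have := h (u ++ p) ((List.prefix_append_right_inj u).2 hp)
    simp only [List.count_append] at this
    push_cast at this
    constructor <;> linarith [this.1, this.2]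
  · rintro ⟨h1, h2⟩ p hp
    rcases List.prefix_or_prefix_of_prefix hp (List.prefix_append u v) with h | ⟨q, rfl⟩
    · exact h1 p h
    · have := h2 q ((List.prefix_append_right_inj u).1 hp)
      simp only [List.count_append]
      push_cast
      constructor <;> linarith [this.1, this.2]

lemma tracks_cons (x y : V) (d : ℤ) (z : V) (w : List V) :
    Tracks x y d (z :: w) ↔ (0 ≤ d ∧ d ≤ 1) ∧
      Tracks x y (d + (if z = x then 1 else 0) - (if z = y then 1 else 0)) w := by
  have : z :: w = [z] ++ w := rfl
  rw [this, tracks_append]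
  have e : ∀ a : V, (([z] : List V).count a : ℤ) = if z = a then 1 else 0 := by
    intro a; rw [List.count_singleton]; by_cases h : z = a <;> simp [h]
  rw [e, e]
  constructor
  · rintro ⟨h1, h2⟩
    refine ⟨?_, h2⟩
    simpa using h1 [] (by simp)
  · rintro ⟨h1, h2⟩
    refine ⟨?_, h2⟩
    intro p hp
    have h3 := h2 [] (by simp)
    simp only [List.count_nil] at h3
    rw [List.prefix_cons_iff] at hp
    rcases hp with rfl | ⟨t, rfl, ht⟩
    · simpa using h1
    · have : t = [] := by simpa using ht
      subst this
      rw [e, e]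
      simpa using h3

lemma tracks_swap (x y : V) (w : List V) : Tracks x y 1 w ↔ Tracks y x 0 w := by
  unfold Tracks
  constructor <;> intro h p hp <;> have := h p hp <;> constructor <;> omega

lemma alternates_def (w : List V) (x y : V) : Alternates w x y ↔
    (w.filter (fun z => z = x ∨ z = y)).IsChain (· ≠ ·) := Iff.rfl

lemma tracks_iff (w : List V) : ∀ x y : V, x ≠ y → (Tracks x y 0 w ↔
    Alternates w x y ∧ (w.filter (fun z => z = x ∨ z = y)).head? ≠ some y) := by
  induction w with
  | nil => intro x y _; simp [tracks_nil, alternates_def]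
  | cons z w ih =>
    intro x y hxy
    rw [tracks_cons]
    have hcomm : (w.filter (fun z => z = y ∨ z = x)) = (w.filter (fun z => z = x ∨ z = y)) := by
      congr 1; funext z; simp [or_comm]
    by_cases h1 : z = x
    · subst h1
      have := ih y z hxy.symm
      simp only [hxy, if_true, if_false]
      rw [show (0 : ℤ) + 1 - 0 = 1 by norm_num, tracks_swap, this]
      simp only [alternates_def]
      rw [hcomm]
      simp only [true_or, decide_true, List.filter_cons_of_pos, List.isChain_cons]
      simp [hxy]
      grind
    · by_cases h2 : z = y
      · subst h2
        simp only [hxy.symm, if_true, if_false]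
        simp only [alternates_def]
        simp
        intro h
        have := h [] (by simp)
        simp at this
      · simp only [h1, h2, if_false]
        simp only [add_zero, sub_zero]
        rw [ih x y hxy]
        simp [alternates_def, h1, h2]

lemma alternates_comm (w : List V) (x y : V) : Alternates w x y ↔ Alternates w y x := by
  simp only [alternates_def]
  have hcomm : (w.filter (fun z => z = y ∨ z = x)) = (w.filter (fun z => z = x ∨ z = y)) := by
    congr 1; funext z; simp [or_comm]
  rw [hcomm]

lemma alternates_iff (w : List V) (x y : V) (hxy : x ≠ y) :
    Alternates w x y ↔ Tracks x y 0 w ∨ Tracks y x 0 w := by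
  rw [tracks_iff w x y hxy, tracks_iff w y x hxy.symm, alternates_comm w y x]
  have hcomm : (w.filter (fun z => z = y ∨ z = x)) = (w.filter (fun z => z = x ∨ z = y)) := by
    congr 1; funext z; simp [or_comm]
  rw [hcomm]
  constructor
  · intro h
    by_cases h' : (w.filter (fun z => z = x ∨ z = y)).head? = some y
    · right; refine ⟨h, ?_⟩; rw [h']; simpa using hxy.symm
    · left; exact ⟨h, h'⟩
  · rintro (h | h) <;> exact h.1

lemma tracks_idxOf (w : List V) (x y : V) (hy : y ∈ w) (hxy : x ≠ y) (h : Tracks x y 0 w) :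
    w.idxOf x < w.idxOf y := by
  by_contra hle
  push Not at hle
  have h1 := h (w.take (w.idxOf y + 1)) (List.take_prefix _ _)
  have hlt : w.idxOf y < w.length := List.idxOf_lt_length_iff.2 hy
  have hymem : y ∈ w.take (w.idxOf y + 1) := by
    rw [List.mem_take_iff_getElem]
    refine ⟨w.idxOf y, by simp; omega, by simp⟩
  have hc : 1 ≤ (w.take (w.idxOf y + 1)).count y := List.one_le_count_iff.2 hymem
  have hxnot : x ∉ w.take (w.idxOf y + 1) := by
    intro hx
    rw [List.mem_take_iff_getElem] at hx
    obtain ⟨i, hi, hix⟩ := hx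
    have h2 : w.idxOf x ≤ i := by
      by_contra hcon
      push Not at hcon
      have := List.not_of_lt_findIdx hcon
      simp [hix] at this
    have h3 : i = w.idxOf y := by omega
    subst h3
    simp at hix
    exact hxy hix.symm
  rw [List.count_eq_zero_of_not_mem hxnot] at h1
  omega

/-- The order pattern that a word-representable graph satisfies. -/
def OrdQ {α : Type*} [LT α] (G : SimpleGraph α) : Prop :=
  ∀ a b c d : α, a < b → b < c → c < d → G.Adj a b → G.Adj b c → G.Adj c d → G.Adj a d → G.Adj a c

lemma wr_pattern (G : SimpleGraph V) (w : List V) (hw : Represents w G) (a b c d : V)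
    (hab : w.idxOf a < w.idxOf b) (hbc : w.idxOf b < w.idxOf c) (hcd : w.idxOf c < w.idxOf d)
    (h1 : G.Adj a b) (h2 : G.Adj b c) (h3 : G.Adj c d) (h4 : G.Adj a d) : G.Adj a c := by
  have key : ∀ x y, w.idxOf x < w.idxOf y → G.Adj x y → Tracks x y 0 w := by
    intro x y hlt hadj
    have := (hw.2 x y hadj.ne).2 hadj
    rw [alternates_iff _ _ _ hadj.ne] at this
    rcases this with h | h
    · exact h
    · have := tracks_idxOf w y x (hw.1 x) hadj.ne.symm h
      omega
  have t1 := key _ _ hab h1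
  have t2 := key _ _ hbc h2
  have t3 := key _ _ hcd h3
  have t4 := key _ _ (by omega) h4
  have hac : a ≠ c := by rintro rfl; omega
  rw [← hw.2 a c hac, alternates_iff _ _ _ hac]
  left
  intro p hp
  have := t1 p hp
  have := t2 p hp
  have := t3 p hp
  have := t4 p hp
  constructor <;> omega

end words

lemma exists_ordQ_iso {n : ℕ} (G : SimpleGraph (Fin n)) (hG : WordRepresentable G) :
    ∃ H : SimpleGraph (Fin n), OrdQ H ∧ WordRepresentable H ∧ Nonempty (H ≃g G) := by
  obtain ⟨w, hw⟩ := hG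
  let f : Fin n → ℕ := fun v => w.idxOf v
  have hinj : Function.Injective f := by
    intro x y hxy
    exact (List.idxOf_inj (hw.1 x)).1 hxy
  let σ := Tuple.sort f
  have hmono : StrictMono (f ∘ σ) :=
    (Tuple.monotone_sort f).strictMono_of_injective (hinj.comp σ.injective)
  refine ⟨G.comap σ, ?_, ?_, ⟨SimpleGraph.Iso.comap σ G⟩⟩
  · intro a b c d h1 h2 h3 e1 e2 e3 e4
    exact wr_pattern G w hw _ _ _ _ (hmono h1) (hmono h2) (hmono h3) e1 e2 e3 e4
  · refine ⟨w.map σ.symm, ?_, ?_⟩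
    · intro v
      rw [List.mem_map]
      exact ⟨σ v, hw.1 _, by simp⟩
    · intro x y hxy
      rw [SimpleGraph.comap_adj, ← hw.2 _ _ (by simpa using hxy)]
      simp only [alternates_def]
      rw [List.filter_map]
      have : ((fun z => decide (z = x ∨ z = y)) ∘ σ.symm) =
          fun z => decide (z = σ x ∨ z = σ y) := by
        funext z; simp [Equiv.symm_apply_eq]
      rw [this, List.isChain_map]
      simp

/-! ### Three-colourable graphs are word-representable -/

section tripartite
variable {V : Type*} [DecidableEq V]

/-- The word in which the vertex `v` is visited exactly at the times `p v` and `q v`. -/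
def visits (l : List V) (p q : V → ℕ) (N : ℕ) : List V :=
  (List.range N).flatMap (fun i => l.filter (fun v => p v = i ∨ q v = i))

lemma visits_succ (l : List V) (p q : V → ℕ) (N : ℕ) :
    visits l p q (N + 1) = visits l p q N ++ l.filter (fun v => p v = N ∨ q v = N) := by
  simp [visits, List.range_succ]

lemma visits_prefix (l : List V) (p q : V → ℕ) (M N : ℕ) (h : M ≤ N) :
    visits l p q M <+: visits l p q N := by
  induction N, h using Nat.le_induction with
  | base => exact List.prefix_rfl
  | succ N _ ih => rw [visits_succ]; exact ih.trans (List.prefix_append _ _)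

lemma count_seg (l : List V) (hl : ∀ v, l.count v = 1) (P : V → Prop) [DecidablePred P] (v : V) :
    (l.filter (fun v => P v)).count v = if P v then 1 else 0 := by
  split_ifs with h
  · rw [List.count_filter (by simpa using h), hl]
  · rw [List.count_eq_zero]; simp [h]

lemma count_visits (l : List V) (hl : ∀ v, l.count v = 1) (p q : V → ℕ) (hpq : ∀ v, p v < q v)
    (N : ℕ) (v : V) : (visits l p q N).count v =
      (if p v < N then 1 else 0) + (if q v < N then 1 else 0) := by
  induction N with
  | zero => simp [visits]
  | succ N ih =>
    rw [visits_succ, List.count_append, ih, count_seg l hl]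
    have := hpq v
    split_ifs <;> omega

lemma tracks_of_count_right (x y : V) (d : ℤ) (u : List V) (hy : u.count y = 0) (h0 : 0 ≤ d)
    (h1 : d + u.count x ≤ 1) : Tracks x y d u := by
  intro p hp
  have e1 := hp.sublist.count_le x
  have e2 := hp.sublist.count_le y
  omega

lemma tracks_of_count_left (x y : V) (d : ℤ) (u : List V) (hy : u.count x = 0)
    (h0 : 0 ≤ d - u.count y) (h1 : d ≤ 1) : Tracks x y d u := by
  intro p hp
  have e1 := hp.sublist.count_le x
  have e2 := hp.sublist.count_le y
  omega

lemma tracks_visits (l : List V) (hl : ∀ v, l.count v = 1) (p q : V → ℕ) (hpq : ∀ v, p v < q v)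
    (x y : V) (h1 : p x < p y) (h2 : p y < q x) (h3 : q x < q y) (N : ℕ) :
    Tracks x y 0 (visits l p q N) := by
  induction N with
  | zero => simp [visits, tracks_nil]
  | succ N ih =>
    rw [visits_succ, tracks_append]
    refine ⟨ih, ?_⟩
    have cx := count_seg l hl (fun v => p v = N ∨ q v = N) x
    have cy := count_seg l hl (fun v => p v = N ∨ q v = N) y
    by_cases hx : p x = N ∨ q x = N
    · have hy : ¬ (p y = N ∨ q y = N) := by omega
      rw [if_pos hx] at cx
      rw [if_neg hy] at cy
      apply tracks_of_count_right _ _ _ _ cy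
      · rw [count_visits l hl p q hpq, count_visits l hl p q hpq]; split_ifs <;> simp <;> omega
      · rw [count_visits l hl p q hpq, count_visits l hl p q hpq, cx]; split_ifs <;> simp <;> omega
    · rw [if_neg hx] at cx
      apply tracks_of_count_left _ _ _ _ cx
      · rw [count_visits l hl p q hpq, count_visits l hl p q hpq, cy]; split_ifs <;> simp <;> omega
      · rw [count_visits l hl p q hpq, count_visits l hl p q hpq]; split_ifs <;> simp <;> omega

lemma not_tracks_visits (l : List V) (hl : ∀ v, l.count v = 1) (p q : V → ℕ)
    (hpq : ∀ v, p v < q v) (x y : V) (N : ℕ) (hN : ∀ v, q v < N)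
    (h : p y < p x ∨ q x < p y) :
    ¬ Tracks x y 0 (visits l p q N) := by
  intro ht
  have := hpq x
  have := hpq y
  rcases h with h | h
  · have h1 := ht _ (visits_prefix l p q (p y + 1) N (by have := hN y; omega))
    rw [count_visits l hl p q hpq, count_visits l hl p q hpq, if_neg (by omega),
      if_neg (by omega), if_pos (by omega)] at h1
    push_cast at h1
    split_ifs at h1 <;> omega
  · have h1 := ht _ (visits_prefix l p q (q x + 1) N (by have := hN x; omega))
    rw [count_visits l hl p q hpq, count_visits l hl p q hpq, if_pos (by omega),
      if_pos (by omega), if_neg (by omega), if_neg (by omega)] at h1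
    norm_num at h1

/-- An admissible pair of visiting times with respect to the oriented edge relation `E`. -/
structure Adm (E : V → V → Prop) (p q : V → ℕ) (N : ℕ) : Prop where
  lt : ∀ v, p v < q v
  bd : ∀ v, q v < N
  edge : ∀ x y, E x y → p x < p y ∧ p y < q x ∧ q x < q y

lemma wr_of_blocks [Fintype V] (G : SimpleGraph V) (E : V → V → Prop)
    (hE : ∀ x y, G.Adj x y ↔ E x y ∨ E y x) (N : ℕ)
    (hb : ∀ x y, ¬ E x y → ∃ p q, Adm E p q N ∧ (x ≠ y → p y < p x ∨ q x < p y)) :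
    WordRepresentable G := by
  classical
  set l : List V := (Finset.univ : Finset V).toList with hl
  have hlc : ∀ v, l.count v = 1 := fun v =>
    List.count_eq_one_of_mem (Finset.nodup_toList _) (by simp [hl])
  have hirr : ∀ v, ¬ E v v := by
    intro v hv
    exact G.loopless.irrefl v ((hE v v).2 (Or.inl hv))
  have hb' : ∀ x y, ∃ p q, Adm E p q N ∧ (¬ E x y → x ≠ y → p y < p x ∨ q x < p y) := by
    intro x y
    by_cases h : E x y
    · obtain ⟨p, q, h1, -⟩ := hb x x (hirr x)
      exact ⟨p, q, h1, fun h' => absurd h h'⟩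
    · obtain ⟨p, q, h1, h2⟩ := hb x y h
      exact ⟨p, q, h1, fun _ => h2⟩
  choose P Q hA hsep using hb'
  let blk : V × V → List V := fun z => visits l (P z.1 z.2) (Q z.1 z.2) N
  have hcnt : ∀ z v, (blk z).count v = 2 := by
    intro z v
    have h1 := (hA z.1 z.2).lt v
    have h2 := (hA z.1 z.2).bd v
    simp only [blk]
    rw [count_visits l hlc _ _ (hA z.1 z.2).lt, if_pos (by omega), if_pos (by omega)]
  have htr : ∀ (x y : V) (L : List (V × V)),
      (Tracks x y 0 (L.flatMap blk) ↔ ∀ z ∈ L, Tracks x y 0 (blk z)) := by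
    intro x y L
    induction L with
    | nil => simp [tracks_nil]
    | cons z L ih =>
      rw [List.flatMap_cons, tracks_append, hcnt, hcnt]
      simp only [zero_add, sub_self, ih, List.mem_cons, forall_eq_or_imp]
  refine ⟨(Finset.univ : Finset (V × V)).toList.flatMap blk, ?_, ?_⟩
  · intro v
    rw [List.mem_flatMap]
    refine ⟨(v, v), by simp, ?_⟩
    rw [← List.count_pos_iff, hcnt]; norm_num
  · have key : ∀ x y, x ≠ y → (Tracks x y 0 ((Finset.univ : Finset (V × V)).toList.flatMap blk)
        ↔ E x y) := by
      intro x y hxy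
      rw [htr]
      constructor
      · intro h
        by_contra hn
        exact not_tracks_visits l hlc _ _ (hA x y).lt x y N (hA x y).bd (hsep x y hn hxy)
          (h (x, y) (by simp))
      · intro h z _
        obtain ⟨e1, e2, e3⟩ := (hA z.1 z.2).edge x y h
        exact tracks_visits l hlc _ _ (hA z.1 z.2).lt x y e1 e2 e3 N
    intro x y hxy
    rw [alternates_iff _ _ _ hxy, key x y hxy, key y x hxy.symm, hE]

lemma wr_of_three_col [Fintype V] (G : SimpleGraph V) (col : V → ℕ) (hc : ∀ v, col v < 3)
    (hG : ∀ x y, G.Adj x y → col x ≠ col y) : WordRepresentable G := by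
  classical
  refine wr_of_blocks G (fun x y => G.Adj x y ∧ col x < col y) ?_ 40 ?_
  · intro x y
    constructor
    · intro h
      rcases lt_or_gt_of_ne (hG x y h) with h' | h'
      · exact Or.inl ⟨h, h'⟩
      · exact Or.inr ⟨h.symm, h'⟩
    · rintro (h | h)
      · exact h.1
      · exact h.1.symm
  intro x y hxy
  by_cases h1 : col y ≤ col x
  · -- the vertex `y` comes first in its colour class
    refine ⟨fun u => 3 * col u + if u = y then 0 else 1,
      fun u => 3 * col u + (if u = y then 0 else 1) + 10, ⟨?_, ?_, ?_⟩, ?_⟩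
    · intro v; simp
    · intro v; have := hc v; split_ifs <;> omega
    · rintro a b ⟨-, hab⟩
      have := hc a; have := hc b
      split_ifs <;> omega
    · intro hne
      left
      simp [hne]; omega
  push Not at h1
  have hn : ¬ G.Adj x y := fun h => hxy ⟨h, h1⟩
  by_cases h2 : col y = col x + 1
  · -- move `y` before all its non-neighbours of the previous colour
    refine ⟨fun u => if u = y then 4 * col x + 1 else
        if col u = col x ∧ ¬ G.Adj u y then 4 * col x + 2 else 4 * col u,
      fun u => (if u = y then 4 * col x + 1 else
        if col u = col x ∧ ¬ G.Adj u y then 4 * col x + 2 else 4 * col u) + 15, ⟨?_, ?_, ?_⟩, ?_⟩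
    · intro v; simp
    · intro v; have := hc v; have := hc x; split_ifs <;> omega
    · rintro a b ⟨hadj, hab⟩
      have := hc a; have := hc b
      have hay : a = y → col a = col y := fun h => by rw [h]
      have hby : b = y → col b = col y := fun h => by rw [h]
      have hby' : b = y → G.Adj a y := fun h => by rw [← h]; exact hadj
      by_cases ha : a = y <;> by_cases hb : b = y
      · subst ha; subst hb; omega
      · simp only [ha, hb, if_true, if_false]
        have := hay ha
        split_ifs <;> omega
      · simp only [ha, hb, if_true, if_false]
        have := hby hb
        have := hby' hb
        simp only [this, not_true, and_false, if_false]
        omega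
      · simp only [ha, hb, if_false]
        split_ifs <;> omega
    · intro hne
      left
      simp [hne, hn]
  · -- the colours of `x` and `y` are `0` and `2`: visit `x` twice before `y`
    have hx0 : col x = 0 := by have := hc y; omega
    have hy2 : col y = 2 := by have := hc y; omega
    refine ⟨fun u => if col u = 0 then 0 else if col u = 1 then 1 else
        if G.Adj x u then 2 else 4,
      fun u => if u = x then 3 else if col u = 0 then 5 else if col u = 1 then 6 else 7,
      ⟨?_, ?_, ?_⟩, ?_⟩
    · intro v; have := hc v
      by_cases hv : v = x
      · subst hv; simp [hx0]
      · simp only [hv, if_false]; split_ifs <;> omega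
    · intro v; split_ifs <;> omega
    · rintro a b ⟨hadj, hab⟩
      have := hc a; have := hc b
      have hbx : b ≠ x := by rintro rfl; omega
      simp only [hbx, if_false]
      by_cases hax : a = x
      · subst hax
        simp only [hadj, if_true, hx0]
        split_ifs <;> omega
      · simp only [hax, if_false]
        split_ifs <;> omega
    · intro _
      right
      simp [hy2, hn]

end tripartite

/-! ### Counting reductions -/

lemma numUnlabelled_le (n : ℕ) :
    numUnlabelled n ≤ Nat.card {H : SimpleGraph (Fin n) // OrdQ H} := by
  classical
  let r := fun G H : {G : SimpleGraph (Fin n) // WordRepresentable G} => Nonempty (G.1 ≃g H.1)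
  have h1 : numUnlabelled n ≤
      Nat.card {H : {G : SimpleGraph (Fin n) // WordRepresentable G} // OrdQ H.1} := by
    refine Nat.card_le_card_of_surjective (fun H => Quot.mk r H.1) ?_
    intro q
    induction q using Quot.ind with
    | mk G =>
      obtain ⟨H, h1, h2, h3⟩ := exists_ordQ_iso G.1 G.2
      exact ⟨⟨⟨H, h2⟩, h1⟩, Quot.sound h3⟩
  refine h1.trans ?_
  refine Nat.card_le_card_of_injective (fun H => ⟨H.1.1, H.2⟩) ?_
  intro a b hab
  simp only [Subtype.mk.injEq] at hab
  exact Subtype.ext (Subtype.ext hab)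

lemma ordQ_card_le (n : ℕ) :
    Nat.card {H : SimpleGraph (Fin n) // OrdQ H} ≤
      Nat.card {H : SimpleGraph (Fin n) // H.CliqueFree 4} := by
  classical
  let F : Finset (Finset (Sym2 (Fin n))) :=
    (Finset.univ.filter (fun G : SimpleGraph (Fin n) => OrdQ G)).image (fun G => G.edgeFinset)
  have hF : ∀ u, u ∈ F → ∃ G : SimpleGraph (Fin n), OrdQ G ∧ ∀ e, e ∈ u ↔ e ∈ G.edgeSet := by
    intro u hu
    simp only [F, Finset.mem_image, Finset.mem_filter, Finset.mem_univ, true_and] at hu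
    obtain ⟨G, h1, h2⟩ := hu
    refine ⟨G, h1, fun e => ?_⟩
    rw [← h2, SimpleGraph.mem_edgeFinset]
  have hcardF : Nat.card {H : SimpleGraph (Fin n) // OrdQ H} = F.card := by
    rw [Nat.card_eq_fintype_card, Fintype.card_subtype]
    rw [Finset.card_image_of_injective]
    intro G H h
    exact SimpleGraph.edgeFinset_inj.1 h
  rw [hcardF]
  refine (Finset.card_le_card_shatterer F).trans ?_
  have hdiag : ∀ S ∈ F.shatterer, ∀ e ∈ S, ¬ e.IsDiag := by
    intro S hS e he hd
    rw [Finset.mem_shatterer] at hS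
    obtain ⟨u, hu, hSu⟩ := hS (Finset.singleton_subset_iff.2 he)
    obtain ⟨G, -, hG⟩ := hF u hu
    have : e ∈ S ∩ u := by rw [hSu]; simp
    exact G.not_isDiag_of_mem_edgeSet ((hG e).1 (Finset.mem_inter.1 this).2) hd
  rw [Nat.card_eq_fintype_card, Fintype.card_subtype]
  refine Finset.card_le_card_of_injOn (fun S => SimpleGraph.fromEdgeSet (S : Set (Sym2 (Fin n))))
    ?_ ?_
  · intro S hS
    simp only [Finset.coe_filter, Finset.mem_univ, true_and, Set.mem_ofPred_eq]
    intro t ht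
    have hS' := Finset.mem_shatterer.1 (Finset.mem_coe.1 hS)
    let f := t.orderEmbOfFin ht.card_eq
    have hadj : ∀ i j : Fin 4, i < j → s(f i, f j) ∈ S := by
      intro i j hij
      have := ht.isClique (t.orderEmbOfFin_mem ht.card_eq i) (t.orderEmbOfFin_mem ht.card_eq j)
        (by simpa using hij.ne)
      rw [SimpleGraph.fromEdgeSet_adj] at this
      exact this.1
    obtain ⟨u, hu, hSu⟩ := hS' (Finset.erase_subset s(f 0, f 2) S)
    obtain ⟨G, hQ, hG⟩ := hF u hu
    have hmem : ∀ i j : Fin 4, i < j → s(f i, f j) ≠ s(f 0, f 2) → G.Adj (f i) (f j) := by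
      intro i j hij hne
      have : s(f i, f j) ∈ S ∩ u := by
        rw [hSu]; exact Finset.mem_erase.2 ⟨hne, hadj i j hij⟩
      exact (hG _).1 (Finset.mem_inter.1 this).2
    have hinj := f.injective
    have h02 : G.Adj (f 0) (f 2) := by
      apply hQ (f 0) (f 1) (f 2) (f 3) (f.strictMono (by decide)) (f.strictMono (by decide))
        (f.strictMono (by decide))
      all_goals
        apply hmem _ _ (by decide)
        simp [hinj.eq_iff]
    have h3 : s(f 0, f 2) ∈ S ∩ u :=
      Finset.mem_inter.2 ⟨hadj 0 2 (by decide), (hG _).2 h02⟩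
    rw [hSu] at h3
    simp at h3
  · intro S hS T hT h
    have key : ∀ S ∈ F.shatterer,
        (SimpleGraph.fromEdgeSet (S : Set (Sym2 (Fin n)))).edgeSet = S := by
      intro S hS
      rw [SimpleGraph.edgeSet_fromEdgeSet]
      ext e
      simp only [Set.mem_sdiff, Finset.mem_coe]
      exact ⟨fun h => h.1, fun h => ⟨h, hdiag S hS e h⟩⟩
    have := congrArg SimpleGraph.edgeSet h
    dsimp only at this
    rw [key S hS, key T hT] at this
    exact_mod_cast this

lemma wr_card_le (n : ℕ) :
    Nat.card {H : SimpleGraph (Fin n) // WordRepresentable H} ≤ n.factorial * numUnlabelled n := by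
  classical
  let r := fun G H : {G : SimpleGraph (Fin n) // WordRepresentable G} => Nonempty (G.1 ≃g H.1)
  have hr : Equivalence r := by
    refine ⟨fun G => ⟨SimpleGraph.Iso.refl⟩, fun h => ?_, fun h h' => ?_⟩
    · exact h.map SimpleGraph.Iso.symm
    · obtain ⟨e⟩ := h
      obtain ⟨e'⟩ := h'
      exact ⟨e.trans e'⟩
  have h1 : Nat.card (Equiv.Perm (Fin n) × Quot r) = n.factorial * numUnlabelled n := by
    rw [Nat.card_prod, Nat.card_eq_fintype_card, Fintype.card_perm, Fintype.card_fin]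
    rfl
  rw [← h1]
  have hout : ∀ G : {H : SimpleGraph (Fin n) // WordRepresentable H},
      ∃ σ : Equiv.Perm (Fin n), (Quot.out (Quot.mk r G)).1.comap σ = G.1 := by
    intro G
    have h2 : Quot.mk r (Quot.out (Quot.mk r G)) = Quot.mk r G := Quot.out_eq _
    have h3 : r (Quot.out (Quot.mk r G)) G := hr.quot_mk_eq_iff _ _ |>.1 h2
    obtain ⟨e⟩ := h3
    refine ⟨e.symm.toEquiv, ?_⟩
    ext a b
    rw [SimpleGraph.comap_adj]
    exact e.symm.map_rel_iff
  choose σ hσ using hout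
  refine Nat.card_le_card_of_injective (fun G => (σ G, Quot.mk r G)) ?_
  intro G H h
  simp only [Prod.mk.injEq] at h
  apply Subtype.ext
  rw [← hσ G, ← hσ H, h.1, h.2]

lemma tripartite_card (n : ℕ) :
    2 ^ (3 * (n / 3) ^ 2) ≤ Nat.card {H : SimpleGraph (Fin n) // WordRepresentable H} := by
  classical
  set m := n / 3 with hm
  let e : ZMod 3 → Fin m → Fin n := fun i a => ⟨3 * a.1 + i.val, by
    have := a.2; have := ZMod.val_lt i; omega⟩
  have hval : ∀ i a, (e i a).1 = 3 * a.1 + i.val := fun i a => rfl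
  have hinj : ∀ i a j b, e i a = e j b → i = j ∧ a = b := by
    intro i a j b h
    have h1 := congrArg Fin.val h
    rw [hval, hval] at h1
    have := ZMod.val_lt i
    have := ZMod.val_lt j
    exact ⟨ZMod.val_injective 3 (by omega), Fin.ext (by omega)⟩
  let g : Set (ZMod 3 × Fin m × Fin m) → SimpleGraph (Fin n) := fun T =>
    SimpleGraph.fromRel (fun u v => ∃ t ∈ T, u = e t.1 t.2.1 ∧ v = e (t.1 + 1) t.2.2)
  have hcol : ∀ i a, (e i a).1 % 3 = i.val := by
    intro i a
    rw [hval]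
    have := ZMod.val_lt i
    omega
  have hne : ∀ i : ZMod 3, i.val ≠ (i + 1).val := by decide
  have hWR : ∀ T, WordRepresentable (g T) := by
    intro T
    refine wr_of_three_col _ (fun v => v.1 % 3) (fun v => Nat.mod_lt _ (by norm_num)) ?_
    intro x y h
    simp only [g, SimpleGraph.fromRel_adj] at h
    obtain ⟨-, ⟨t, -, rfl, rfl⟩ | ⟨t, -, rfl, rfl⟩⟩ := h
    · simp only [hcol]; exact hne _
    · simp only [hcol]; exact (hne _).symm
  have hrec : ∀ T i a b, (i, a, b) ∈ T ↔ (g T).Adj (e i a) (e (i + 1) b) := by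
    intro T i a b
    simp only [g, SimpleGraph.fromRel_adj]
    constructor
    · intro h
      refine ⟨?_, Or.inl ⟨_, h, rfl, rfl⟩⟩
      intro h'
      exact hne i (congrArg ZMod.val (hinj _ _ _ _ h').1)
    · rintro ⟨-, ⟨⟨i', a', b'⟩, ht, h1, h2⟩ | ⟨⟨i', a', b'⟩, ht, h1, h2⟩⟩
      · obtain ⟨rfl, rfl⟩ := hinj _ _ _ _ h1
        obtain ⟨-, rfl⟩ := hinj _ _ _ _ h2
        exact ht
      · have q1 := (hinj _ _ _ _ h1).1
        have q2 := (hinj _ _ _ _ h2).1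
        exfalso
        simp only at q1 q2
        have : ∀ i i' : ZMod 3, i + 1 = i' → i = i' + 1 → False := by decide
        exact this _ _ q1 q2
  have hcard : Nat.card (Set (ZMod 3 × Fin m × Fin m)) = 2 ^ (3 * m ^ 2) := by
    rw [Nat.card_eq_fintype_card, Fintype.card_set]
    simp [ZMod.card, sq]
  rw [← hcard]
  refine Nat.card_le_card_of_injective (fun T => ⟨g T, hWR T⟩) ?_
  intro T T' h
  simp only [Subtype.mk.injEq] at h
  ext ⟨i, a, b⟩
  rw [hrec, hrec, h]

/-! ### Counting graphs without a large complete multipartite subgraph -/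

/-- The sets `S i` have size `t` and are completely joined to each other in `G`. -/
def Wit {V : Type*} (G : SimpleGraph V) (k t : ℕ) (S : Fin k → Finset V) : Prop :=
  (∀ i, (S i).card = t) ∧ ∀ i j, i ≠ j → ∀ a ∈ S i, ∀ b ∈ S j, G.Adj a b

/-- `G` contains the complete `k`-partite graph with parts of size `t`. -/
def HasMulti {V : Type*} (k t : ℕ) (G : SimpleGraph V) : Prop := ∃ S, Wit G k t S

lemma sum_fun_count {V α : Type*} [Fintype V] [DecidableEq V] (X : Finset α) (hX : 1 ≤ X.card)
    (bad : α → Prop) [DecidablePred bad] (M : ℕ) :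
    (((Fintype.piFinset (fun _ : V => X)).filter
      (fun τ => (Finset.univ.filter (fun v => bad (τ v))).card ≤ M)).card : ℝ) ≤
      (X.card : ℝ) ^ M * ((X.filter (fun x => ¬ bad x)).card + 1 : ℝ) ^ Fintype.card V := by
  set L : ℝ := (X.card : ℝ) with hL
  have hL1 : (1 : ℝ) ≤ L := by rw [hL]; exact_mod_cast hX
  have hL0 : 0 < L := by linarith
  let w : α → ℝ := fun x => if bad x then L⁻¹ else 1
  have hw0 : ∀ x, 0 ≤ w x := by intro x; simp only [w]; split_ifs <;> positivity
  have h1 : ∑ x ∈ X, w x ≤ ((X.filter (fun x => ¬ bad x)).card + 1 : ℝ) := by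
    simp only [w]
    rw [Finset.sum_ite]
    simp only [Finset.sum_const, nsmul_eq_mul, mul_one]
    have : ((X.filter bad).card : ℝ) ≤ L := by rw [hL]; exact_mod_cast Finset.card_filter_le _ _
    have : ((X.filter bad).card : ℝ) * L⁻¹ ≤ 1 := by
      rw [← div_eq_mul_inv]; exact (div_le_one hL0).2 this
    linarith
  have h2 : (∑ x ∈ X, w x) ^ Fintype.card V =
      ∑ τ ∈ Fintype.piFinset (fun _ : V => X), ∏ v, w (τ v) := by
    rw [← Finset.prod_univ_sum]; simp
  have h3 : (∑ x ∈ X, w x) ^ Fintype.card V ≤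
      ((X.filter (fun x => ¬ bad x)).card + 1 : ℝ) ^ Fintype.card V := by
    gcongr
  set A := (Fintype.piFinset (fun _ : V => X)).filter
      (fun τ => (Finset.univ.filter (fun v => bad (τ v))).card ≤ M) with hA
  have h4 : (A.card : ℝ) * (L⁻¹) ^ M ≤
      ∑ τ ∈ Fintype.piFinset (fun _ : V => X), ∏ v, w (τ v) := by
    calc (A.card : ℝ) * (L⁻¹) ^ M = ∑ τ ∈ A, (L⁻¹) ^ M := by simp
      _ ≤ ∑ τ ∈ A, ∏ v, w (τ v) := by
        apply Finset.sum_le_sum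
        intro τ hτ
        have hle := (Finset.mem_filter.1 hτ).2
        simp only [w]
        rw [Finset.prod_ite]
        simp only [Finset.prod_const, one_pow, mul_one]
        exact pow_le_pow_of_le_one (by positivity) (inv_le_one_of_one_le₀ hL1) hle
      _ ≤ _ := by
        apply Finset.sum_le_sum_of_subset_of_nonneg (Finset.filter_subset _ _)
        intro τ _ _
        exact Finset.prod_nonneg fun v _ => hw0 _
  have h5 : (A.card : ℝ) * (L⁻¹) ^ M ≤
      ((X.filter (fun x => ¬ bad x)).card + 1 : ℝ) ^ Fintype.card V := by
    rw [← h2] at h4; exact h4.trans h3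
  rw [inv_pow, ← div_eq_mul_inv, div_le_iff₀ (by positivity)] at h5
  linarith

lemma small_subsets_card {V : Type*} [DecidableEq V] (A : Finset V) (t s : ℕ) (hA : A.card = t)
    (ht : 1 ≤ t) : (A.powerset.filter (fun Y => Y.card < s)).card ≤ s * t ^ s := by
  have : A.powerset.filter (fun Y => Y.card < s) ⊆
      (Finset.range s).biUnion (fun j => A.powersetCard j) := by
    intro Y hY
    rw [Finset.mem_filter, Finset.mem_powerset] at hY
    rw [Finset.mem_biUnion]
    exact ⟨Y.card, by simpa using hY.2, Finset.mem_powersetCard.2 ⟨hY.1, rfl⟩⟩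
  refine (Finset.card_le_card this).trans (Finset.card_biUnion_le.trans ?_)
  calc ∑ j ∈ Finset.range s, (A.powersetCard j).card ≤ ∑ j ∈ Finset.range s, t ^ s := by
        apply Finset.sum_le_sum
        intro j hj
        rw [Finset.card_powersetCard, hA]
        exact (Nat.choose_le_pow t j).trans
          (Nat.pow_le_pow_right ht (Finset.mem_range.1 hj).le)
    _ = s * t ^ s := by simp

lemma good_traces_card {V : Type*} [DecidableEq V] (k t s : ℕ) (ht : 1 ≤ t)
    (S : Fin (k + 1) → Finset V) (hS : ∀ i, (S i).card = t) (B : Finset V)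
    (hB : B.card = (k + 1) * t) (hSB : ∀ i, S i ⊆ B) :
    (B.powerset.filter (fun X => ¬ ∀ i, s ≤ (X ∩ S i).card)).card ≤
      (k + 1) * (s * t ^ s) * 2 ^ (k * t) := by
  have hsub : B.powerset.filter (fun X => ¬ ∀ i, s ≤ (X ∩ S i).card) ⊆
      Finset.univ.biUnion (fun i => B.powerset.filter (fun X => (X ∩ S i).card < s)) := by
    intro X hX
    rw [Finset.mem_filter] at hX
    obtain ⟨h1, h2⟩ := hX
    push Not at h2
    obtain ⟨i, hi⟩ := h2
    rw [Finset.mem_biUnion]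
    exact ⟨i, Finset.mem_univ _, Finset.mem_filter.2 ⟨h1, hi⟩⟩
  refine (Finset.card_le_card hsub).trans (Finset.card_biUnion_le.trans ?_)
  have hone : ∀ i, (B.powerset.filter (fun X => (X ∩ S i).card < s)).card ≤
      (s * t ^ s) * 2 ^ (k * t) := by
    intro i
    have hc : (B \ S i).card = k * t := by
      rw [Finset.card_sdiff_of_subset (hSB i), hB, hS i, Nat.add_mul]; omega
    have : (B.powerset.filter (fun X => (X ∩ S i).card < s)).card ≤
        (((S i).powerset.filter (fun Y => Y.card < s)) ×ˢ (B \ S i).powerset).card := by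
      apply Finset.card_le_card_of_injOn (fun X => (X ∩ S i, X \ S i))
      · intro X hX
        simp only [Finset.coe_filter, Set.mem_ofPred_eq, Finset.mem_powerset] at hX
        simp only [Finset.coe_product, Set.mem_prod, Finset.mem_coe, Finset.mem_filter,
          Finset.mem_powerset]
        exact ⟨⟨Finset.inter_subset_right, hX.2⟩, Finset.sdiff_subset_sdiff hX.1 le_rfl⟩
      · intro X _ Y _ h
        simp only [Prod.mk.injEq] at h
        rw [← Finset.sdiff_union_inter X (S i), ← Finset.sdiff_union_inter Y (S i), h.1, h.2]
    rw [Finset.card_product, Finset.card_powerset, hc] at this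
    exact this.trans (Nat.mul_le_mul_right _ (small_subsets_card _ t s (hS i) ht))
  refine (Finset.sum_le_sum fun i _ => hone i).trans ?_
  simp [mul_assoc]

lemma hasMulti_induce {V : Type*} (k s : ℕ) (G : SimpleGraph V) (P : V → Prop)
    (h : HasMulti k s (G.comap (Subtype.val : {v // P v} → V))) : HasMulti k s G := by
  classical
  obtain ⟨S, h1, h2⟩ := h
  refine ⟨fun i => (S i).map (Function.Embedding.subtype _), ?_, ?_⟩
  · intro i; rw [Finset.card_map, h1]
  · intro i j hij a ha b hb
    rw [Finset.mem_map] at ha hb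
    obtain ⟨a, ha, rfl⟩ := ha
    obtain ⟨b, hb, rfl⟩ := hb
    exact h2 i j hij a ha b hb

open Classical in
lemma bad_card_le {V : Type*} [Fintype V] (G : SimpleGraph V) (k t s : ℕ)
    (S : Fin k → Finset V) (hW : Wit G k t S) (B : Finset V)
    (hG : ¬ HasMulti (k + 1) s G) :
    (Finset.univ.filter (fun v => ∀ i, s ≤
      ((B.filter (fun b => G.Adj v b)) ∩ S i).card)).card ≤ s * 2 ^ B.card := by
  by_contra hcon
  push Not at hcon
  rw [mul_comm, ← Finset.card_powerset] at hcon
  obtain ⟨Y, hY, hlt⟩ := Finset.exists_lt_card_fiber_of_mul_lt_card_of_maps_to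
    (f := fun v => B.filter (fun b => G.Adj v b)) (fun v _ => by simp) hcon
  apply hG
  obtain ⟨U, hU, hUc⟩ := Finset.exists_subset_card_eq hlt.le
  have hUm : ∀ v ∈ U, (∀ i, s ≤ (Y ∩ S i).card) ∧ B.filter (fun b => G.Adj v b) = Y := by
    intro v hv
    have := hU hv
    simp only [Finset.mem_filter, Finset.mem_univ, true_and] at this
    obtain ⟨h1, h2⟩ := this
    rw [h2] at h1
    exact ⟨h1, h2⟩
  rcases Nat.eq_zero_or_pos s with hs | hs
  · subst hs
    refine ⟨fun _ => ∅, by simp, by simp⟩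
  obtain ⟨v0, hv0⟩ : U.Nonempty := by rw [← Finset.card_pos]; omega
  choose R hR hRc using fun i => Finset.exists_subset_card_eq ((hUm v0 hv0).1 i)
  have hadj : ∀ v ∈ U, ∀ i, ∀ b ∈ R i, G.Adj v b := by
    intro v hv i b hb
    have h1 := (Finset.mem_inter.1 (hR i hb)).1
    rw [← (hUm v hv).2] at h1
    exact (Finset.mem_filter.1 h1).2
  refine ⟨Fin.cons U R, ?_, ?_⟩
  · intro i
    refine Fin.cases ?_ (fun i => ?_) i
    · simpa using hUc
    · simpa using hRc i
  · intro i j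
    refine Fin.cases ?_ (fun i => ?_) i <;> refine Fin.cases ?_ (fun j => ?_) j
    · intro h; exact absurd rfl h
    · intro _ a ha b hb
      simp only [Fin.cons_zero, Fin.cons_succ] at ha hb
      exact hadj a ha j b hb
    · intro _ a ha b hb
      simp only [Fin.cons_zero, Fin.cons_succ] at ha hb
      exact (hadj b hb i a ha).symm
    · intro hij a ha b hb
      simp only [Fin.cons_succ] at ha hb
      exact hW.2 i j (by rintro rfl; exact hij rfl) a (Finset.mem_inter.1 (hR i ha)).2 b
        (Finset.mem_inter.1 (hR j hb)).2

open Classical in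
/-- The number of graphs on `V` without the complete `k`-partite graph with parts of size `s`. -/
noncomputable def cnt (k s : ℕ) (V : Type) [Fintype V] : ℕ :=
  (Finset.univ.filter (fun G : SimpleGraph V => ¬ HasMulti k s G)).card

lemma wit_disjoint {V : Type*} (G : SimpleGraph V) (k t : ℕ) (S : Fin k → Finset V)
    (hW : Wit G k t S) (i j : Fin k) (hij : i ≠ j) : Disjoint (S i) (S j) := by
  rw [Finset.disjoint_left]
  intro a ha hb
  exact (hW.2 i j hij a ha a hb).ne rfl

open Classical in
lemma peel {V : Type} [Fintype V] (k t s : ℕ) (ht : 1 ≤ t) (S : Fin (k + 1) → Finset V)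
    (b : ℝ) (hb0 : 0 ≤ b)
    (hb : ∀ (W : Type) [Fintype W], Fintype.card W + (k + 1) * t = Fintype.card V →
      (cnt (k + 2) s W : ℝ) ≤ b) :
    ((Finset.univ.filter (fun G : SimpleGraph V =>
      ¬ HasMulti (k + 2) s G ∧ Wit G (k + 1) t S)).card : ℝ) ≤
      (2 : ℝ) ^ ((k + 1) * t * (s * 2 ^ ((k + 1) * t))) *
      (((k + 1) * (s * t ^ s) * 2 ^ (k * t) : ℕ) + 1 : ℝ) ^ Fintype.card V * b := by
  set A := Finset.univ.filter (fun G : SimpleGraph V =>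
      ¬ HasMulti (k + 2) s G ∧ Wit G (k + 1) t S) with hA
  rcases A.eq_empty_or_nonempty with hE | ⟨G0, hG0⟩
  · rw [hE]; simp only [Finset.card_empty, Nat.cast_zero]; positivity
  have hW0 : Wit G0 (k + 1) t S := by
    rw [hA, Finset.mem_filter] at hG0; exact hG0.2.2
  set B : Finset V := Finset.univ.biUnion S with hB
  have hSB : ∀ i, S i ⊆ B := fun i => Finset.subset_biUnion_of_mem S (Finset.mem_univ i)
  have hBc : B.card = (k + 1) * t := by
    rw [hB, Finset.card_biUnion (fun i _ j _ hij => wit_disjoint G0 _ t S hW0 i j hij)]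
    simp [hW0.1]
  let W := {v : V // v ∉ B}
  have hWc : Fintype.card W + (k + 1) * t = Fintype.card V := by
    rw [← hBc]
    have h1 : Fintype.card W = Fintype.card V - B.card := by
      rw [Fintype.card_subtype_compl]; simp
    have := B.card_le_univ
    omega
  let T := (Fintype.piFinset (fun _ : V => B.powerset)).filter
      (fun τ => (Finset.univ.filter (fun v => ∀ i, s ≤ (τ v ∩ S i).card)).card
        ≤ s * 2 ^ ((k + 1) * t))
  let C := Finset.univ.filter (fun G : SimpleGraph W => ¬ HasMulti (k + 2) s G)
  have hinj : A.card ≤ (T ×ˢ C).card := by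
    apply Finset.card_le_card_of_injOn
      (fun G => (fun v => B.filter (fun b => G.Adj v b), G.comap (Subtype.val : W → V)))
    · intro G hG
      rw [Finset.mem_coe, hA, Finset.mem_filter] at hG
      obtain ⟨-, h1, h2⟩ := hG
      rw [Finset.mem_coe, Finset.mem_product]
      refine ⟨?_, ?_⟩
      · simp only [T, Finset.mem_filter, Fintype.mem_piFinset, Finset.mem_powerset]
        refine ⟨fun v => Finset.filter_subset _ _, ?_⟩
        rw [← hBc]
        exact bad_card_le G (k + 1) t s S h2 B h1
      · simp only [C, Finset.mem_filter, Finset.mem_univ, true_and]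
        exact fun h => h1 (hasMulti_induce _ _ _ _ h)
    · intro G _ H _ h
      simp only [Prod.mk.injEq] at h
      obtain ⟨h1, h2⟩ := h
      have key : ∀ u v, v ∈ B → (G.Adj u v ↔ H.Adj u v) := by
        intro u v hv
        have := congrFun h1 u
        have := Finset.ext_iff.1 this v
        simpa [hv] using this
      ext u v
      by_cases hv : v ∈ B
      · exact key u v hv
      · by_cases hu : u ∈ B
        · rw [G.adj_comm, H.adj_comm]; exact key v u hu
        · have : (G.comap (Subtype.val : W → V)).Adj ⟨u, hu⟩ ⟨v, hv⟩ ↔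
              (H.comap (Subtype.val : W → V)).Adj ⟨u, hu⟩ ⟨v, hv⟩ := by rw [h2]
          simpa using this
  have hC : (C.card : ℝ) ≤ b := by
    have := hb W hWc
    convert this using 1
    simp only [C, cnt]
    congr!
  have hT : (T.card : ℝ) ≤ (2 : ℝ) ^ ((k + 1) * t * (s * 2 ^ ((k + 1) * t))) *
      (((k + 1) * (s * t ^ s) * 2 ^ (k * t) : ℕ) + 1 : ℝ) ^ Fintype.card V := by
    have h1 := sum_fun_count (V := V) B.powerset
      (by rw [Finset.card_powerset]; exact Nat.one_le_two_pow)
      (fun X => ∀ i, s ≤ (X ∩ S i).card) (s * 2 ^ ((k + 1) * t))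
    have h2 := good_traces_card k t s ht S hW0.1 B hBc hSB
    have h3 : ((B.powerset.filter (fun X => ¬ ∀ i, s ≤ (X ∩ S i).card)).card : ℝ) ≤
      (((k + 1) * (s * t ^ s) * 2 ^ (k * t) : ℕ) : ℝ) := by exact_mod_cast h2
    refine le_trans (le_of_eq ?_) (h1.trans ?_)
    · simp only [T]
    · rw [Finset.card_powerset, hBc, Nat.cast_pow, Nat.cast_ofNat, ← pow_mul]
      gcongr
  calc (A.card : ℝ) ≤ ((T ×ˢ C).card : ℝ) := by exact_mod_cast hinj
    _ = (T.card : ℝ) * C.card := by rw [Finset.card_product]; push_cast; ring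
    _ ≤ _ := by gcongr

open Classical in
lemma cnt_rec {V : Type} [Fintype V] (k t s : ℕ) (ht : 1 ≤ t)
    (b : ℝ) (hb0 : 0 ≤ b)
    (hb : ∀ (W : Type) [Fintype W], Fintype.card W + (k + 1) * t = Fintype.card V →
      (cnt (k + 2) s W : ℝ) ≤ b) :
    (cnt (k + 2) s V : ℝ) ≤ cnt (k + 1) t V + (Fintype.card V : ℝ) ^ ((k + 1) * t) *
      ((2 : ℝ) ^ ((k + 1) * t * (s * 2 ^ ((k + 1) * t))) *
      (((k + 1) * (s * t ^ s) * 2 ^ (k * t) : ℕ) + 1 : ℝ) ^ Fintype.card V * b) := by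
  set R := ((2 : ℝ) ^ ((k + 1) * t * (s * 2 ^ ((k + 1) * t))) *
      (((k + 1) * (s * t ^ s) * 2 ^ (k * t) : ℕ) + 1 : ℝ) ^ Fintype.card V * b) with hR
  have hR0 : 0 ≤ R := by positivity
  let I : Finset (Fin (k + 1) → Finset V) :=
    Fintype.piFinset (fun _ => (Finset.univ : Finset V).powersetCard t)
  let A : (Fin (k + 1) → Finset V) → Finset (SimpleGraph V) := fun S =>
    Finset.univ.filter (fun G : SimpleGraph V => ¬ HasMulti (k + 2) s G ∧ Wit G (k + 1) t S)
  have hsub : Finset.univ.filter (fun G : SimpleGraph V => ¬ HasMulti (k + 2) s G) ⊆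
      Finset.univ.filter (fun G : SimpleGraph V => ¬ HasMulti (k + 1) t G) ∪ I.biUnion A := by
    intro G hG
    simp only [Finset.mem_filter, Finset.mem_univ, true_and] at hG
    rw [Finset.mem_union]
    by_cases h : HasMulti (k + 1) t G
    · right
      obtain ⟨S, hS⟩ := h
      rw [Finset.mem_biUnion]
      refine ⟨S, ?_, ?_⟩
      · simp only [I, Fintype.mem_piFinset, Finset.mem_powersetCard]
        exact fun i => ⟨Finset.subset_univ _, hS.1 i⟩
      · simp only [A, Finset.mem_filter, Finset.mem_univ, true_and]
        exact ⟨hG, hS⟩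
    · left; simpa using h
  have h1 : cnt (k + 2) s V ≤ cnt (k + 1) t V + ∑ S ∈ I, (A S).card := by
    refine (Finset.card_le_card hsub).trans ((Finset.card_union_le _ _).trans ?_)
    exact Nat.add_le_add_left Finset.card_biUnion_le _
  have h2 : ((∑ S ∈ I, (A S).card : ℕ) : ℝ) ≤ (I.card : ℝ) * R := by
    push_cast
    calc ∑ S ∈ I, ((A S).card : ℝ) ≤ ∑ S ∈ I, R :=
          Finset.sum_le_sum fun S _ => peel k t s ht S b hb0 hb
      _ = _ := by simp
  have h3 : (I.card : ℝ) ≤ (Fintype.card V : ℝ) ^ ((k + 1) * t) := by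
    have : I.card ≤ Fintype.card V ^ ((k + 1) * t) := by
      simp only [I, Fintype.card_piFinset, Finset.card_powersetCard, Finset.prod_const,
        Finset.card_univ, Fintype.card_fin]
      rw [mul_comm, pow_mul]
      exact Nat.pow_le_pow_left (Nat.choose_le_pow _ _) _
    exact_mod_cast this
  calc (cnt (k + 2) s V : ℝ) ≤ ((cnt (k + 1) t V + ∑ S ∈ I, (A S).card : ℕ) : ℝ) := by
        exact_mod_cast h1
    _ = cnt (k + 1) t V + ((∑ S ∈ I, (A S).card : ℕ) : ℝ) := by push_cast; ring
    _ ≤ _ := by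
      have := mul_le_mul_of_nonneg_right h3 hR0
      linarith

lemma cnt_le_pow (k s : ℕ) (V : Type) [Fintype V] :
    cnt k s V ≤ 2 ^ (Fintype.card V ^ 2) := by
  classical
  refine (Finset.card_le_univ _).trans ?_
  have h1 : Fintype.card (V → V → Bool) = 2 ^ (Fintype.card V ^ 2) := by
    simp [sq, pow_mul]
  rw [← h1]
  refine Fintype.card_le_of_injective (fun G u v => decide (G.Adj u v)) ?_
  intro G H h
  ext u v
  simpa using congrFun (congrFun h u) v

/-- Twice the asymptotic density exponent. -/
noncomputable def rate (k : ℕ) : ℝ := ((k : ℝ) - 1) / k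

lemma rate_succ (k : ℕ) : rate (k + 1) * (k + 1) = k := by
  unfold rate
  push_cast
  have : (k : ℝ) + 1 ≠ 0 := by positivity
  field_simp
  ring

lemma rate_succ_nonneg (k : ℕ) : 0 ≤ rate (k + 1) := by
  unfold rate
  push_cast
  have : (0 : ℝ) ≤ k := by positivity
  apply div_nonneg <;> linarith

lemma rate_mono (k : ℕ) : rate k ≤ rate (k + 1) := by
  rcases Nat.eq_zero_or_pos k with h | h
  · subst h; simp [rate]
  · unfold rate
    have : (0 : ℝ) < k := by exact_mod_cast h
    push_cast
    rw [div_le_div_iff₀ this (by linarith)]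
    nlinarith

lemma exists_t (k s : ℕ) (ε : ℝ) (hε : 0 < ε) :
    ∃ t : ℕ, 1 ≤ t ∧ ((k + 1 : ℝ) * (s * (t : ℝ) ^ s)) + 1 ≤ (2 : ℝ) ^ (ε * t) := by
  have hx : |(2 : ℝ) ^ (-ε)| < 1 := by
    rw [abs_of_pos (by positivity)]
    exact Real.rpow_lt_one_of_one_lt_of_neg (by norm_num) (by linarith)
  have h1 := tendsto_pow_const_mul_const_pow_of_abs_lt_one s hx
  have h2 := tendsto_pow_atTop_nhds_zero_of_abs_lt_one hx
  have h3 := (h1.const_mul ((k + 1 : ℝ) * s)).add h2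
  simp only [mul_zero, add_zero] at h3
  have h4 := (h3.eventually (gt_mem_nhds (show (0 : ℝ) < 1 by norm_num))).and
    (Filter.eventually_ge_atTop 1)
  obtain ⟨t, ht, ht1⟩ := h4.exists
  refine ⟨t, ht1, ?_⟩
  have e : ((2 : ℝ) ^ (-ε)) ^ t = ((2 : ℝ) ^ (ε * t))⁻¹ := by
    rw [← Real.rpow_natCast, ← Real.rpow_mul (by norm_num), ← Real.rpow_neg (by norm_num)]
    congr 1; ring
  rw [e] at ht
  set X := (2 : ℝ) ^ (ε * t)
  have hX : 0 < X := by positivity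
  have : ((k + 1 : ℝ) * s * ((t : ℝ) ^ s * X⁻¹) + X⁻¹) * X =
      ((k + 1 : ℝ) * (s * (t : ℝ) ^ s)) + 1 := by
    field_simp
  rw [← this]
  nlinarith

lemma exists_n0 (m : ℕ) (C δ : ℝ) (hδ : 0 < δ) :
    ∃ n0 : ℕ, ∀ n : ℕ, n0 ≤ n → (n : ℝ) ^ m * C * (2 : ℝ) ^ (-(δ * n)) ≤ 1 / 2 := by
  have hx : |(2 : ℝ) ^ (-δ)| < 1 := by
    rw [abs_of_pos (by positivity)]
    exact Real.rpow_lt_one_of_one_lt_of_neg (by norm_num) (by linarith)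
  have h1 := (tendsto_pow_const_mul_const_pow_of_abs_lt_one m hx).const_mul C
  simp only [mul_zero] at h1
  have h4 := h1.eventually (gt_mem_nhds (show (0 : ℝ) < 1 / 2 by norm_num))
  obtain ⟨n0, hn0⟩ := Filter.eventually_atTop.1 h4
  refine ⟨n0, fun n hn => ?_⟩
  have := hn0 n hn
  have e : ((2 : ℝ) ^ (-δ)) ^ n = (2 : ℝ) ^ (-(δ * n)) := by
    rw [← Real.rpow_natCast, ← Real.rpow_mul (by norm_num)]
    congr 1; ring
  rw [e] at this
  nlinarith

theorem cnt_bound (k : ℕ) : ∀ (s : ℕ) (ε : ℝ), 0 < ε → ∃ K : ℝ, 0 ≤ K ∧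
    ∀ (V : Type) [Fintype V], (cnt (k + 1) s V : ℝ) ≤
      K * (2 : ℝ) ^ ((rate k / 2 + ε) * (Fintype.card V : ℝ) ^ 2) := by
  induction k with
  | zero =>
    intro s ε hε
    refine ⟨2 ^ (s ^ 2), by positivity, fun V _ => ?_⟩
    have hone : (1 : ℝ) ≤ (2 : ℝ) ^ ((rate 0 / 2 + ε) * (Fintype.card V : ℝ) ^ 2) := by
      apply Real.one_le_rpow (by norm_num)
      simp only [rate]
      norm_num
      positivity
    rcases lt_or_ge (Fintype.card V) s with h | h
    · have h1 := cnt_le_pow (0 + 1) s V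
      have h2 : cnt (0 + 1) s V ≤ 2 ^ (s ^ 2) :=
        h1.trans (Nat.pow_le_pow_right (by norm_num) (Nat.pow_le_pow_left h.le 2))
      have h3 : (cnt (0 + 1) s V : ℝ) ≤ 2 ^ (s ^ 2) := by exact_mod_cast h2
      have : (0 : ℝ) < 2 ^ (s ^ 2) := by positivity
      nlinarith
    · have h1 : cnt (0 + 1) s V = 0 := by
        classical
        simp only [cnt]
        rw [Finset.card_eq_zero, Finset.filter_eq_empty_iff]
        intro G _
        rw [not_not]
        obtain ⟨U, -, hU⟩ := Finset.exists_subset_card_eq (s := (Finset.univ : Finset V)) h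
        refine ⟨fun _ => U, fun _ => hU, fun i j hij => ?_⟩
        exact absurd (Fin.ext (by omega)) hij
      rw [h1]
      simp only [Nat.cast_zero]
      positivity
  | succ k ih =>
    intro s ε hε
    obtain ⟨t, ht1, ht⟩ := exists_t k s ε hε
    obtain ⟨K', hK'0, hK'⟩ := ih t ε hε
    set m : ℕ := (k + 1) * t with hm
    set r : ℝ := rate (k + 1) with hr
    have hr0 : 0 ≤ r := rate_succ_nonneg k
    have hrm : r * m = k * t := by
      rw [hm]; push_cast; rw [← mul_assoc, hr, rate_succ]
    have htm : (t : ℝ) ≤ m := by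
      rw [hm]; push_cast
      have : (0 : ℝ) ≤ k * t := by positivity
      linarith
    have hmpos : (0 : ℝ) < m := by
      have : (1 : ℝ) ≤ t := by exact_mod_cast ht1
      linarith
    set L : ℝ := (2 : ℝ) ^ (m * (s * 2 ^ m)) with hL
    obtain ⟨n0, hn0⟩ := exists_n0 m (L * (2 : ℝ) ^ ((r / 2 + ε) * (m : ℝ) ^ 2)) (ε * m)
      (by positivity)
    set K : ℝ := 2 * K' + 2 ^ (n0 ^ 2) with hK
    have hK0 : 0 ≤ K := by positivity
    -- the number of good traces
    have hg : (((k + 1) * (s * t ^ s) * 2 ^ (k * t) : ℕ) + 1 : ℝ) ≤ (2 : ℝ) ^ ((r + ε) * m) := by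
      have e1 : (2 : ℝ) ^ ((r + ε) * m) = (2 : ℝ) ^ (k * t) * (2 : ℝ) ^ (ε * m) := by
        rw [add_mul, hrm, Real.rpow_add (by norm_num)]
        congr 1
        rw [← Real.rpow_natCast]; push_cast; rfl
      have e2 : (2 : ℝ) ^ (ε * t) ≤ (2 : ℝ) ^ (ε * m) := by
        apply Real.rpow_le_rpow_of_exponent_le (by norm_num)
        gcongr
      have e3 : (1 : ℝ) ≤ (2 : ℝ) ^ (k * t) := one_le_pow₀ (by norm_num)
      rw [e1]
      push_cast
      calc ((k : ℝ) + 1) * (s * t ^ s) * 2 ^ (k * t) + 1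
          ≤ ((k : ℝ) + 1) * (s * t ^ s) * 2 ^ (k * t) + 2 ^ (k * t) := by linarith
        _ = 2 ^ (k * t) * ((((k : ℝ) + 1) * (s * t ^ s)) + 1) := by ring
        _ ≤ 2 ^ (k * t) * (2 : ℝ) ^ (ε * m) := by gcongr; linarith
    refine ⟨K, hK0, ?_⟩
    have main : ∀ n : ℕ, ∀ (V : Type) [Fintype V], Fintype.card V = n →
        (cnt (k + 2) s V : ℝ) ≤ K * (2 : ℝ) ^ ((r / 2 + ε) * (n : ℝ) ^ 2) := by
      intro n
      induction n using Nat.strong_induction_on with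
      | _ n IH =>
      intro V _ hV
      have hone : (1 : ℝ) ≤ (2 : ℝ) ^ ((r / 2 + ε) * (n : ℝ) ^ 2) :=
        Real.one_le_rpow (by norm_num) (by positivity)
      rcases lt_or_ge n n0 with hn | hn
      · have h1 := cnt_le_pow (k + 2) s V
        rw [hV] at h1
        have h2 : cnt (k + 2) s V ≤ 2 ^ (n0 ^ 2) :=
          h1.trans (Nat.pow_le_pow_right (by norm_num) (Nat.pow_le_pow_left hn.le 2))
        have h3 : (cnt (k + 2) s V : ℝ) ≤ 2 ^ (n0 ^ 2) := by exact_mod_cast h2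
        nlinarith
      set P : ℝ := (2 : ℝ) ^ ((r / 2 + ε) * (n : ℝ) ^ 2) with hP
      have hrec := cnt_rec (V := V) k t s ht1
        (K * (2 : ℝ) ^ ((r / 2 + ε) * ((n : ℝ) - m) ^ 2)) (by positivity) (by
          intro W _ hW
          rw [hV, ← hm] at hW
          have hm1 : 0 < m := by exact_mod_cast hmpos
          have := IH (Fintype.card W) (by omega) W rfl
          have e : (n : ℝ) - m = Fintype.card W := by rw [← hW]; push_cast; ring
          rw [e]; exact this)
      rw [hV] at hrec
      have hfirst : (cnt (k + 1) t V : ℝ) ≤ K' * P := by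
        refine (hK' V).trans ?_
        rw [hV]
        refine mul_le_mul_of_nonneg_left ?_ hK'0
        refine Real.rpow_le_rpow_of_exponent_le (by norm_num) ?_
        have := rate_mono k
        gcongr
      have hsecond : (n : ℝ) ^ m * (L *
          (((k + 1) * (s * t ^ s) * 2 ^ (k * t) : ℕ) + 1 : ℝ) ^ n *
          (K * (2 : ℝ) ^ ((r / 2 + ε) * ((n : ℝ) - m) ^ 2))) ≤ K * P * (1 / 2) := by
        have e1 : (((k + 1) * (s * t ^ s) * 2 ^ (k * t) : ℕ) + 1 : ℝ) ^ n ≤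
            (2 : ℝ) ^ ((r + ε) * m * n) := by
          rw [Real.rpow_mul (by norm_num), Real.rpow_natCast]
          gcongr
        have e2 : (2 : ℝ) ^ ((r + ε) * m * n) * (2 : ℝ) ^ ((r / 2 + ε) * ((n : ℝ) - m) ^ 2) =
            P * ((2 : ℝ) ^ ((r / 2 + ε) * (m : ℝ) ^ 2) * (2 : ℝ) ^ (-(ε * m * n))) := by
          rw [hP, ← Real.rpow_add (by norm_num), ← Real.rpow_add (by norm_num),
            ← Real.rpow_add (by norm_num)]
          congr 1; ring
        calc _ ≤ (n : ℝ) ^ m * (L * (2 : ℝ) ^ ((r + ε) * m * n) *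
              (K * (2 : ℝ) ^ ((r / 2 + ε) * ((n : ℝ) - m) ^ 2))) := by gcongr
          _ = (n : ℝ) ^ m * L * K * ((2 : ℝ) ^ ((r + ε) * m * n) *
              (2 : ℝ) ^ ((r / 2 + ε) * ((n : ℝ) - m) ^ 2)) := by ring
          _ = K * P * ((n : ℝ) ^ m * (L * (2 : ℝ) ^ ((r / 2 + ε) * (m : ℝ) ^ 2)) *
              (2 : ℝ) ^ (-(ε * m * n))) := by rw [e2]; ring
          _ ≤ _ := by
            apply mul_le_mul_of_nonneg_left (hn0 n hn)
            positivity
      have hKK : 2 * K' ≤ K := by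
        rw [hK]; have : (0 : ℝ) < 2 ^ (n0 ^ 2) := by positivity
        linarith
      have hP0 : 0 < P := by linarith
      calc (cnt (k + 2) s V : ℝ) ≤ _ := hrec
        _ ≤ K' * P + K * P * (1 / 2) := add_le_add hfirst hsecond
        _ ≤ K * P := by nlinarith
    intro V _
    exact main _ V rfl

lemma cliqueFree_card_le (n : ℕ) :
    Nat.card {H : SimpleGraph (Fin n) // H.CliqueFree 4} ≤ cnt 4 1 (Fin n) := by
  classical
  rw [Nat.card_eq_fintype_card, Fintype.card_subtype]
  unfold cnt
  refine le_trans (Finset.card_le_card (t := Finset.univ.filter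
    (fun G : SimpleGraph (Fin n) => ¬ HasMulti 4 1 G)) ?_) (le_of_eq (by congr!))
  intro G hG
  simp only [Finset.mem_filter, Finset.mem_univ, true_and] at hG ⊢
  rintro ⟨S, h1, h2⟩
  choose f hf using fun i => Finset.card_eq_one.1 (h1 i)
  have hadj : ∀ i j, i ≠ j → G.Adj (f i) (f j) := fun i j hij =>
    h2 i j hij _ (by simp [hf]) _ (by simp [hf])
  have hinj : Function.Injective f := by
    intro i j hij
    by_contra hne
    exact (hadj i j hne).ne hij
  refine hG (Finset.univ.map ⟨f, hinj⟩) ⟨?_, by simp⟩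
  intro a ha b hb hab
  simp only [Finset.coe_map, Function.Embedding.coeFn_mk, Finset.coe_univ, Set.image_univ,
    Set.mem_range] at ha hb
  obtain ⟨i, rfl⟩ := ha
  obtain ⟨j, rfl⟩ := hb
  exact hadj i j (by rintro rfl; exact hab rfl)

/-! ### The asymptotic statement -/

lemma upper_bound (ε : ℝ) (hε : 0 < ε) : ∃ K : ℝ, 0 < K ∧ ∀ n : ℕ,
    (numUnlabelled n : ℝ) ≤ K * (2 : ℝ) ^ ((1 / 3 + ε) * (n : ℝ) ^ 2) := by
  obtain ⟨K, hK0, hK⟩ := cnt_bound 3 1 ε hε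
  refine ⟨K + 1, by positivity, fun n => ?_⟩
  have h1 := (numUnlabelled_le n).trans ((ordQ_card_le n).trans (cliqueFree_card_le n))
  have h2 : (numUnlabelled n : ℝ) ≤ (cnt 4 1 (Fin n) : ℝ) := by exact_mod_cast h1
  have h3 := hK (Fin n)
  have hr : rate 3 / 2 = 1 / 3 := by norm_num [rate]
  rw [hr, Fintype.card_fin] at h3
  refine h2.trans (h3.trans ?_)
  gcongr
  linarith

lemma lower_bound (n : ℕ) : (2 : ℝ) ^ (3 * (n / 3) ^ 2) ≤ (n : ℝ) ^ n * numUnlabelled n := by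
  have h := (tripartite_card n).trans ((wr_card_le n).trans
    (Nat.mul_le_mul_right _ (Nat.factorial_le_pow n)))
  exact_mod_cast h

theorem unlabelled_count_asymptotics :
    Filter.Tendsto
      (fun n : ℕ => (Real.logb 2 (numUnlabelled n) - (n : ℝ) ^ 2 / 3) / (n : ℝ) ^ 2)
      Filter.atTop (nhds 0) := by
  have hcast : Filter.Tendsto (fun n : ℕ => (n : ℝ)) Filter.atTop Filter.atTop :=
    tendsto_natCast_atTop_atTop
  have hinv : Filter.Tendsto (fun n : ℕ => ((n : ℝ))⁻¹) Filter.atTop (nhds 0) :=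
    tendsto_inv_atTop_zero.comp hcast
  have hlog : Filter.Tendsto (fun n : ℕ => Real.logb 2 (n : ℝ) * ((n : ℝ))⁻¹)
      Filter.atTop (nhds 0) := by
    have h1 := (Real.tendsto_pow_log_div_mul_add_atTop 1 0 1 (by norm_num)).comp hcast
    have h2 := h1.mul_const ((Real.log 2)⁻¹)
    simp only [zero_mul] at h2
    refine h2.congr fun n => ?_
    simp only [Function.comp, pow_one, one_mul, add_zero, Real.logb, div_eq_mul_inv]
    ring
  have hpos : ∀ n : ℕ, 1 ≤ n → (0 : ℝ) < numUnlabelled n := by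
    intro n hn
    have h1 := lower_bound n
    have h2 : (0 : ℝ) < (2 : ℝ) ^ (3 * (n / 3) ^ 2) := by positivity
    by_contra hcon
    have h3 : (numUnlabelled n : ℝ) = 0 := le_antisymm (not_lt.1 hcon) (Nat.cast_nonneg _)
    rw [h3, mul_zero] at h1
    linarith
  rw [tendsto_order]
  constructor
  · intro a ha
    have hlow : Filter.Tendsto (fun n : ℕ => -(4 / 3) * ((n : ℝ))⁻¹ -
        Real.logb 2 (n : ℝ) * ((n : ℝ))⁻¹) Filter.atTop (nhds 0) := by
      simpa using (hinv.const_mul (-(4 / 3))).sub hlog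
    filter_upwards [hlow.eventually (lt_mem_nhds ha), Filter.eventually_ge_atTop 1] with n h1 hn
    refine h1.trans_le ?_
    have hn0 : (0 : ℝ) < n := by exact_mod_cast hn
    have h2 := lower_bound n
    have h3 := Real.logb_le_logb_of_le (b := 2) (by norm_num) (by positivity) h2
    rw [Real.logb_mul (by positivity) (hpos n hn).ne', Real.logb_pow, Real.logb_pow,
      Real.logb_self_eq_one (by norm_num)] at h3
    have h4 : ((n : ℝ) - 2) ≤ 3 * ((n / 3 : ℕ) : ℝ) := by
      have : n ≤ 3 * (n / 3) + 2 := by omega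
      have : (n : ℝ) ≤ 3 * ((n / 3 : ℕ) : ℝ) + 2 := by exact_mod_cast this
      linarith
    have h4' : 3 * ((n / 3 : ℕ) : ℝ) ≤ n := by
      have : 3 * (n / 3) ≤ n := by omega
      exact_mod_cast this
    have h5 : (n : ℝ) ^ 2 / 3 - 4 / 3 * n ≤ 3 * ((n / 3 : ℕ) : ℝ) ^ 2 := by
      nlinarith
    push_cast at h3
    rw [le_div_iff₀ (by positivity)]
    have h6 : (-(4 / 3) * ((n : ℝ))⁻¹ - Real.logb 2 (n : ℝ) * ((n : ℝ))⁻¹) * (n : ℝ) ^ 2 =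
        -(4 / 3) * n - n * Real.logb 2 n := by
      field_simp
    rw [h6]
    linarith
  · intro a ha
    obtain ⟨K, hK0, hK⟩ := upper_bound (a / 2) (by linarith)
    have hup : Filter.Tendsto (fun n : ℕ => Real.logb 2 K * (((n : ℝ))⁻¹ * ((n : ℝ))⁻¹) + a / 2)
        Filter.atTop (nhds (a / 2)) := by
      simpa using ((hinv.mul hinv).const_mul (Real.logb 2 K)).add_const (a / 2)
    filter_upwards [hup.eventually (gt_mem_nhds (show a / 2 < a by linarith)),
      Filter.eventually_ge_atTop 1] with n h1 hn
    refine lt_of_le_of_lt ?_ h1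
    have hn0 : (0 : ℝ) < n := by exact_mod_cast hn
    have h3 := Real.logb_le_logb_of_le (b := 2) (by norm_num) (hpos n hn) (hK n)
    rw [Real.logb_mul hK0.ne' (by positivity), Real.logb_rpow (by norm_num) (by norm_num)] at h3
    rw [div_le_iff₀ (by positivity)]
    have h6 : (Real.logb 2 K * (((n : ℝ))⁻¹ * ((n : ℝ))⁻¹) + a / 2) * (n : ℝ) ^ 2 =
        Real.logb 2 K + a / 2 * (n : ℝ) ^ 2 := by
      field_simp
    rw [h6]
    linarith
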